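/- Impossibility in the reconstruction of Price's argument (Section IX): There is no finite set Λ and family of nonnegative reals p(a,λ|x) (a,x ∈ {0,1}, λ ∈ Λ) such that all of the following hold: (i) ∑_{a,λ} p(a,λ|x) = 1 for each x; (ii) ∑_λ p(a,λ|x) > 0 for every pair (a,x) (every preparation output occurs); (iii) the four support sets {λ : p(a,λ|x) > 0} are pairwise disjoint for distinct pairs (a,x) (ψ-ontology); and (iv) ∑_a p(a,λ|0) = ∑_a p(a,λ|1) for every λ ∈ Λ (measurement independence, as implied by No Retrocausality together with Time Symmetry). -/

import Mathlib

/-- **Impossibility in the reconstruction of Price's argument** (Section IX): there is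
no ontic extension of the four-pure-state preparation experiment in which every
preparation output occurs, that satisfies ψ-ontology (pairwise disjoint supports) and
measurement independence (as implied by No Retrocausality together with Time Symmetry). -/
theorem price_argument_impossibility :
    ¬ ∃ (Λ : Type) (_ : Fintype Λ) (p : ZMod 2 → Λ → ZMod 2 → ℝ),
      -- nonnegativity
      (∀ a lam x, 0 ≤ p a lam x) ∧
      -- (i) normalization
      (∀ x : ZMod 2, ∑ a, ∑ lam, p a lam x = 1) ∧
      -- (ii) every preparation output occurs
      (∀ a x : ZMod 2, 0 < ∑ lam, p a lam x) ∧
      -- (iii) ψ-ontology: the four supports are pairwise disjoint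
      (∀ (a x a' x' : ZMod 2), (a, x) ≠ (a', x') →
        ∀ lam, ¬(0 < p a lam x ∧ 0 < p a' lam x')) ∧
      -- (iv) measurement independence
      (∀ lam, ∑ a, p a lam 0 = ∑ a, p a lam 1) := by
  rintro ⟨Λ, _, p, h0, _, h2, h3, h4⟩
  obtain ⟨l, -, hl⟩ := Finset.exists_lt_of_sum_lt
    (s := Finset.univ) (f := fun _ : Λ => (0 : ℝ)) (g := fun l => p 0 l 0)
    (by simpa using h2 0 0)
  have hs : 0 < ∑ a, p a l 1 := by
    rw [← h4 l]
    exact lt_of_lt_of_le hl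
      (Finset.single_le_sum (f := fun a => p a l 0) (fun a _ => h0 a l 0) (Finset.mem_univ 0))
  obtain ⟨a, -, ha⟩ := Finset.exists_lt_of_sum_lt
    (s := Finset.univ) (f := fun _ : ZMod 2 => (0 : ℝ)) (g := fun a => p a l 1)
    (by simpa using hs)
  exact h3 0 0 a 1 (by simp) l ⟨hl, ha⟩
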